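/- Let n ≥ 3 be an integer, let 0 < q ≤ 1 and let x ∈ [0,1]. Then x² ≤ M_n^q(e_2)(x) ≤ x/[n−1]_q + x². -/

import Mathlib

/-- The `q`-integer `[n]_q = 1 + q + ⋯ + q^{n-1}`. -/
noncomputable def qInt (q : ℝ) (n : ℕ) : ℝ := ∑ k ∈ Finset.range n, q ^ k

/-- The `q`-factorial `[n]_q!`. -/
noncomputable def qFact (q : ℝ) (n : ℕ) : ℝ := ∏ k ∈ Finset.range n, qInt q (k + 1)

/-- The `q`-binomial coefficient `[m choose r]_q`. -/
noncomputable def qBinom (q : ℝ) (m r : ℕ) : ℝ := qFact q m / (qFact q r * qFact q (m - r))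

/-- The `q`-Meyer–König–Zeller operator. -/
noncomputable def MKZ (q : ℝ) (n : ℕ) (f : ℝ → ℝ) (x : ℝ) : ℝ :=
  if x = 1 then f 1
  else (∏ j ∈ Finset.range (n + 1), (1 - q ^ j * x)) *
    ∑' k : ℕ, f (qInt q k / qInt q (n + k)) * qBinom q (n + k) k * x ^ k

lemma qInt_succ (q : ℝ) (n : ℕ) : qInt q (n + 1) = qInt q n + q ^ n := by
  simp [qInt, Finset.sum_range_succ]

lemma qInt_succ' (q : ℝ) (n : ℕ) : qInt q (n + 1) = 1 + q * qInt q n := by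
  simp only [qInt, Finset.sum_range_succ', Finset.mul_sum, pow_succ', pow_zero]
  ring

lemma qInt_add (q : ℝ) (m n : ℕ) : qInt q (m + n) = qInt q m + q ^ m * qInt q n := by
  simp [qInt, Finset.sum_range_add, Finset.mul_sum, pow_add]

lemma qInt_nonneg {q : ℝ} (hq : 0 < q) (n : ℕ) : 0 ≤ qInt q n :=
  Finset.sum_nonneg fun _ _ => by positivity

lemma qInt_succ_pos {q : ℝ} (hq : 0 < q) (n : ℕ) : 0 < qInt q (n + 1) := by
  rw [qInt_succ]
  have := qInt_nonneg hq n
  positivity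

lemma qInt_mono {q : ℝ} (hq : 0 < q) : Monotone (qInt q) :=
  monotone_nat_of_le_succ fun n => by
    rw [qInt_succ]
    have := pow_pos hq n
    linarith

lemma qFact_zero (q : ℝ) : qFact q 0 = 1 := by simp [qFact]

lemma qFact_succ (q : ℝ) (n : ℕ) : qFact q (n + 1) = qFact q n * qInt q (n + 1) := by
  simp [qFact, Finset.prod_range_succ]

lemma qFact_pos {q : ℝ} (hq : 0 < q) (n : ℕ) : 0 < qFact q n :=
  Finset.prod_pos fun k _ => qInt_succ_pos hq k

lemma qBinom_add (q : ℝ) (n k : ℕ) :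
    qBinom q (n + k) k = qFact q (n + k) / (qFact q k * qFact q n) := by
  simp [qBinom]

lemma qBinom_add_nonneg {q : ℝ} (hq : 0 < q) (n k : ℕ) : 0 ≤ qBinom q (n + k) k := by
  rw [qBinom_add]
  have := qFact_pos hq (n + k)
  have := qFact_pos hq k
  have := qFact_pos hq n
  positivity

lemma qBinom_add_zero {q : ℝ} (hq : 0 < q) (n : ℕ) : qBinom q (n + 0) 0 = 1 := by
  rw [qBinom_add, qFact_zero, one_mul, add_zero, div_self (qFact_pos hq n).ne']

lemma qBinom_zero_add {q : ℝ} (hq : 0 < q) (k : ℕ) : qBinom q (0 + k) k = 1 := by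
  rw [qBinom_add, qFact_zero, mul_one, zero_add, div_self (qFact_pos hq k).ne']

/-- The absorption identity for `q`-binomial coefficients. -/
lemma qInt_div_mul_qBinom {q : ℝ} (hq : 0 < q) (n k : ℕ) :
    qInt q (k + 1) / qInt q (n + (k + 1)) * qBinom q (n + (k + 1)) (k + 1)
      = qBinom q (n + k) k := by
  rw [qBinom_add, qBinom_add, ← add_assoc, qFact_succ, qFact_succ]
  have := (qFact_pos hq k).ne'
  have := (qFact_pos hq n).ne'
  have := (qInt_succ_pos hq k).ne'
  have := (qInt_succ_pos hq (n + k)).ne'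
  field_simp

/-- The `q`-Pascal identity. -/
lemma qBinom_pascal {q : ℝ} (hq : 0 < q) (n k : ℕ) :
    qBinom q (n + 1 + (k + 1)) (k + 1)
      = qBinom q (n + (k + 1)) (k + 1) + q ^ (n + 1) * qBinom q (n + 1 + k) k := by
  rw [qBinom_add, qBinom_add, qBinom_add, show n + 1 + (k + 1) = n + k + 1 + 1 by ring,
    show n + (k + 1) = n + k + 1 by ring, show n + 1 + k = n + k + 1 by ring,
    qFact_succ q (n + k + 1), qFact_succ q k, qFact_succ q n,
    show n + k + 1 + 1 = (n + 1) + (k + 1) by ring, qInt_add q (n + 1) (k + 1)]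
  have := (qFact_pos hq k).ne'
  have := (qFact_pos hq n).ne'
  have := (qInt_succ_pos hq k).ne'
  have := (qInt_succ_pos hq n).ne'
  field_simp

/-- Summing the recursion `b (k + 1) = a (k + 1) + c * b k`. -/
lemma hasSum_of_linear_recurrence {a b : ℕ → ℝ} {c s : ℝ} (hc1 : c < 1)
    (ha : ∀ k, 0 ≤ a k) (hb : ∀ k, 0 ≤ b k) (hs : HasSum a s) (h0 : b 0 = a 0)
    (hrec : ∀ k, b (k + 1) = a (k + 1) + c * b k) : HasSum b (s / (1 - c)) := by
  have hc : 0 < 1 - c := by linarith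
  have hpartial (N : ℕ) : ∑ k ∈ Finset.range (N + 1), b k
      = ∑ k ∈ Finset.range (N + 1), a k + c * ∑ k ∈ Finset.range N, b k := by
    rw [Finset.sum_range_succ', Finset.sum_range_succ' a, Finset.mul_sum, h0]
    simp only [hrec, Finset.sum_add_distrib]
    ring
  have hsum : Summable b := by
    refine summable_of_sum_range_le (c := s / (1 - c)) hb fun N => ?_
    rw [le_div_iff₀ hc]
    have h1 := hpartial N
    rw [Finset.sum_range_succ b] at h1
    have h2 := sum_le_hasSum (Finset.range (N + 1)) (fun k _ => ha k) hs
    have h3 := hb N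
    linarith
  have hlim := hsum.hasSum.tendsto_sum_nat
  have h1 := (Filter.tendsto_add_atTop_iff_nat 1).2 hlim
  have h2 := ((Filter.tendsto_add_atTop_iff_nat 1).2 hs.tendsto_sum_nat).add (hlim.const_mul c)
  simp only [hpartial] at h1
  have heq := tendsto_nhds_unique h1 h2
  convert hsum.hasSum using 1
  rw [div_eq_iff hc.ne']
  linarith

lemma hasSum_qBinom_mul_pow {q x : ℝ} (hq0 : 0 < q) (hq1 : q ≤ 1) (hx0 : 0 ≤ x) (hx1 : x < 1)
    (n : ℕ) : HasSum (fun k => qBinom q (n + k) k * x ^ k)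
      (∏ j ∈ Finset.range (n + 1), (1 - q ^ j * x))⁻¹ := by
  have hnonneg (m k : ℕ) : 0 ≤ qBinom q (m + k) k * x ^ k :=
    mul_nonneg (qBinom_add_nonneg hq0 m k) (pow_nonneg hx0 k)
  induction n with
  | zero =>
    simp only [qBinom_zero_add hq0]
    simpa using hasSum_geometric_of_lt_one hx0 hx1
  | succ n ih =>
    have hc : q ^ (n + 1) * x < 1 :=
      (mul_le_of_le_one_left hx0 (pow_le_one₀ hq0.le hq1)).trans_lt hx1
    rw [Finset.prod_range_succ, mul_inv, ← div_eq_mul_inv]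
    refine hasSum_of_linear_recurrence hc (hnonneg n) (hnonneg (n + 1)) ih ?_ ?_
    · rw [qBinom_add_zero hq0, qBinom_add_zero hq0]
    · intro k
      rw [qBinom_pascal hq0]
      ring

lemma qInt_div_le_succ {q : ℝ} (hq : 0 < q) {n : ℕ} (hn : 0 < n) (k : ℕ) :
    qInt q k / qInt q (n + k) ≤ qInt q (k + 1) / qInt q (n + (k + 1)) := by
  obtain ⟨m, rfl⟩ := Nat.exists_eq_add_of_lt hn
  have h1 : 0 < qInt q (0 + m + 1 + k) := (qInt_succ_pos hq (m + k)).trans_eq (by congr 1; ring)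
  have h2 : 0 < qInt q (0 + m + 1 + (k + 1)) := qInt_succ_pos hq _
  rw [div_le_div_iff₀ h1 h2, ← add_assoc, qInt_succ q k, qInt_succ q (0 + m + 1 + k),
    add_comm _ k, qInt_add q k, pow_add]
  have h3 := geom_sum_mul q (0 + m + 1)
  have h4 : 0 ≤ q ^ k * qInt q (0 + m + 1) := mul_nonneg (by positivity) (qInt_nonneg hq _)
  have h5 := geom_sum_mul q k
  change qInt q (0 + m + 1) * (q - 1) = _ at h3
  change qInt q k * (q - 1) = _ at h5
  have h6 : (qInt q k + q ^ k) * (qInt q k + q ^ k * qInt q (0 + m + 1))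
      - qInt q k * (qInt q k + q ^ k * qInt q (0 + m + 1) + q ^ k * q ^ (0 + m + 1))
      = q ^ k * qInt q (0 + m + 1) := by
    rw [show q ^ (0 + m + 1) = qInt q (0 + m + 1) * (q - 1) + 1 by linarith,
      show q ^ k = qInt q k * (q - 1) + 1 by linarith]
    ring
  linarith

lemma qInt_div_succ_le {q : ℝ} (hq : 0 < q) {n : ℕ} (hn : 2 ≤ n) (k : ℕ) :
    qInt q (k + 1) / qInt q (n + (k + 1)) ≤ qInt q k / qInt q (n + k) + 1 / qInt q (n - 1) := by
  obtain ⟨m, rfl⟩ := Nat.exists_eq_add_of_le' hn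
  have h0 : 0 < qInt q (m + 2 - 1) := qInt_succ_pos hq m
  have h1 : 0 < qInt q (m + 2 + k) := (qInt_succ_pos hq (m + 1 + k)).trans_eq (by congr 1; ring)
  have h2 : 0 < qInt q (m + 2 + (k + 1)) := qInt_succ_pos hq _
  have h3 : 1 / qInt q (m + 2 + (k + 1)) ≤ 1 / qInt q (m + 2 - 1) :=
    one_div_le_one_div_of_le h0 (qInt_mono hq (by omega))
  have h4 : q * qInt q k / qInt q (m + 2 + (k + 1)) ≤ qInt q k / qInt q (m + 2 + k) := by
    rw [div_le_div_iff₀ h2 h1, ← add_assoc, qInt_succ' q (m + 2 + k)]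
    have := qInt_nonneg hq k
    linarith
  rw [qInt_succ' q k, add_div]
  linarith

theorem stmt2 (q : ℝ) (hq0 : 0 < q) (hq1 : q ≤ 1) (n : ℕ) (hn : 3 ≤ n)
    (x : ℝ) (hx : x ∈ Set.Icc (0 : ℝ) 1) :
    x ^ 2 ≤ MKZ q n (fun t => t ^ 2) x ∧
    MKZ q n (fun t => t ^ 2) x ≤ x / qInt q (n - 1) + x ^ 2 := by
  obtain ⟨hx0, hx1⟩ := hx
  rcases hx1.eq_or_lt with rfl | hx1
  · have := qInt_nonneg hq0 (n - 1)
    simp [MKZ, this]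
  set P := ∏ j ∈ Finset.range (n + 1), (1 - q ^ j * x)
  have hPpos : 0 < P := Finset.prod_pos fun j _ => by
    have := (mul_le_of_le_one_left hx0 (pow_le_one₀ hq0.le hq1 (n := j))).trans_lt hx1
    linarith
  set w : ℕ → ℝ := fun k => qBinom q (n + k) k * x ^ k with hw
  set r : ℕ → ℝ := fun k => qInt q k / qInt q (n + k) with hr
  have hw0 (k : ℕ) : 0 ≤ w k := mul_nonneg (qBinom_add_nonneg hq0 n k) (pow_nonneg hx0 k)
  have hr0 : r 0 = 0 := by simp [hr, qInt]
  have hrw (k : ℕ) : r (k + 1) * w (k + 1) = x * w k := by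
    simp only [hr, hw]
    rw [← mul_assoc, qInt_div_mul_qBinom hq0, pow_succ]
    ring
  have hW : HasSum w P⁻¹ := hasSum_qBinom_mul_pow hq0 hq1 hx0 hx1 n
  have hfirst : HasSum (fun k => r k * w k) (x * P⁻¹) := by
    rw [← hasSum_nat_add_iff' 1]
    simpa [hrw, hr0] using hW.mul_left x
  have hlow (k : ℕ) : x * (r k * w k) ≤ x * (r (k + 1) * w k) :=
    mul_le_mul_of_nonneg_left
      (mul_le_mul_of_nonneg_right (qInt_div_le_succ hq0 (by omega) k) (hw0 k)) hx0
  have hupp (k : ℕ) : x * (r (k + 1) * w k) ≤ x * (r k * w k + 1 / qInt q (n - 1) * w k) := by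
    rw [← add_mul]
    exact mul_le_mul_of_nonneg_left
      (mul_le_mul_of_nonneg_right (qInt_div_succ_le hq0 (by omega) k) (hw0 k)) hx0
  have hUsum := (hfirst.add (hW.mul_left (1 / qInt q (n - 1)))).mul_left x
  have hr_nonneg (k : ℕ) : 0 ≤ r k := div_nonneg (qInt_nonneg hq0 _) (qInt_nonneg hq0 _)
  have hsum : Summable fun k => x * (r (k + 1) * w k) :=
    hUsum.summable.of_nonneg_of_le
      (fun k => mul_nonneg hx0 (mul_nonneg (hr_nonneg _) (hw0 k))) hupp
  have hL := hasSum_le hlow (hfirst.mul_left x) hsum.hasSum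
  have hU := hasSum_le hupp hsum.hasSum hUsum
  have hM : MKZ q n (fun t => t ^ 2) x = P * ∑' k, x * (r (k + 1) * w k) := by
    rw [MKZ, if_neg hx1.ne]
    congr 1
    refine HasSum.tsum_eq ?_
    rw [← hasSum_nat_add_iff' 1]
    have hterm (k : ℕ) : (qInt q (k + 1) / qInt q (n + (k + 1))) ^ 2
        * qBinom q (n + (k + 1)) (k + 1) * x ^ (k + 1) = x * (r (k + 1) * w k) := by
      change r (k + 1) ^ 2 * qBinom q (n + (k + 1)) (k + 1) * x ^ (k + 1) = _
      linear_combination r (k + 1) * hrw k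
    have hzero : qInt q 0 = 0 := by simp [qInt]
    simpa [hterm, hzero] using hsum.hasSum
  rw [hM]
  constructor
  · calc x ^ 2 = P * (x * (x * P⁻¹)) := by field_simp
      _ ≤ _ := mul_le_mul_of_nonneg_left hL hPpos.le
  · calc _ ≤ _ := mul_le_mul_of_nonneg_left hU hPpos.le
      _ = x / qInt q (n - 1) + x ^ 2 := by
        field_simp
        ring
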